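/- Let ν ≥ 0 and r₁, r₂, t > 0, and set z = r₁r₂/(2t). Then ∫₀^∞ e^{-tρ²} J_ν(r₁ρ) J_ν(r₂ρ) ρ dρ = (2t)^{-1} e^{-(r₁²+r₂²)/(4t)} I_ν(z), where J_ν is the Bessel function of the first kind and I_ν the modified Bessel function of the first kind. -/

import Mathlib

/-- Bessel function of the first kind of order `ν`, via the Poisson integral
representation valid for `ν > -1/2`. -/
noncomputable def besselJ (ν r : ℝ) : ℂ :=
  (((r / 2) ^ ν / (Real.Gamma (ν + 1 / 2) * Real.Gamma (1 / 2)) : ℝ) : ℂ) *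
    ∫ s in (-1 : ℝ)..1,
      Complex.exp (Complex.I * (s : ℂ) * (r : ℂ)) *
        (((1 - s ^ 2 : ℝ) ^ ((2 * ν - 1) / 2) : ℝ) : ℂ)

/-- Modified Bessel function of the first kind of order `ν`. -/
noncomputable def besselI (ν z : ℝ) : ℝ :=
  (1 / Real.pi) * (∫ s in (0 : ℝ)..Real.pi, Real.exp (z * Real.cos s) * Real.cos (ν * s)) -
    (Real.sin (ν * Real.pi) / Real.pi) *
      ∫ s in Set.Ioi (0 : ℝ), Real.exp (-z * Real.cosh s) * Real.exp (-s * ν)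

open MeasureTheory Set Filter Topology

lemma aux_hasSum {α : Type*} [MeasurableSpace α] {μ : Measure α} {w : α → ℝ} (hw : Integrable w μ)
    {c : ℕ → ℝ} (hc : Summable (fun n => |c n|)) {g : ℕ → α → ℝ}
    (hg : ∀ n, AEStronglyMeasurable (g n) μ) (hb : ∀ n, ∀ᵐ a ∂μ, |g n a| ≤ 1) {G : α → ℝ}
    (hG : ∀ᵐ a ∂μ, HasSum (fun n => c n * g n a) (G a)) :
    HasSum (fun n => c n * ∫ a, g n a * w a ∂μ) (∫ a, G a * w a ∂μ) := by
  have := hasSum_integral_of_dominated_convergence (μ := μ)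
    (F := fun n a => c n * (g n a * w a)) (f := fun a => G a * w a)
    (fun n a => |c n| * |w a|) (fun n => ((hg n).mul hw.1).const_mul _) ?_ ?_ ?_ ?_
  · simpa only [integral_const_mul] using this
  · intro n
    filter_upwards [hb n] with a ha
    rw [Real.norm_eq_abs, abs_mul, abs_mul]
    gcongr
    exact mul_le_of_le_one_left (abs_nonneg _) ha
  · exact Eventually.of_forall fun a => hc.mul_right _
  · simp_rw [tsum_mul_right]
    exact hw.abs.const_mul _
  · filter_upwards [hG] with a ha
    simpa only [mul_assoc] using ha.mul_right (w a)

lemma aux_exp (x : ℝ) : HasSum (fun n : ℕ => x ^ n / (n.factorial : ℝ)) (Real.exp x) := by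
  rw [Real.exp_eq_exp_ℝ]
  exact NormedSpace.expSeries_div_hasSum_exp x

lemma aux_exp_abs (x : ℝ) : Summable (fun n : ℕ => |x ^ n / (n.factorial : ℝ)|) := by
  refine (aux_exp |x|).summable.congr fun n => ?_
  rw [abs_div, abs_pow, Nat.abs_cast]

lemma aux_trig (a s φ : ℝ) : HasSum (fun n : ℕ => a ^ n / (n.factorial : ℝ) * Real.cos (n * s + φ))
    (Real.exp (a * Real.cos s) * Real.cos (a * Real.sin s + φ)) := by
  have h : HasSum (fun n : ℕ => ((a * Complex.exp (s * Complex.I)) ^ n / (n.factorial : ℂ)))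
      (Complex.exp (a * Complex.exp (s * Complex.I))) := by
    rw [Complex.exp_eq_exp_ℂ]
    exact NormedSpace.expSeries_div_hasSum_exp _
  have h2 := Complex.hasSum_re (h.mul_right (Complex.exp (φ * Complex.I)))
  convert h2 using 1
  · ext n
    have : (a * Complex.exp (s * Complex.I)) ^ n / (n.factorial : ℂ) * Complex.exp (φ * Complex.I)
      = ((a ^ n / (n.factorial : ℝ) : ℝ) : ℂ) * Complex.exp (((n * s + φ : ℝ) : ℂ) * Complex.I) := by
      rw [mul_pow, ← Complex.exp_nat_mul]
      push_cast
      rw [add_mul, Complex.exp_add]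
      ring_nf
    rw [this, Complex.re_ofReal_mul, Complex.exp_ofReal_mul_I_re]
  · rw [← Complex.exp_add]
    have : (a : ℂ) * Complex.exp (s * Complex.I) + φ * Complex.I =
       ((a * Real.cos s : ℝ) : ℂ) + ((a * Real.sin s + φ : ℝ) : ℂ) * Complex.I := by
      rw [Complex.exp_mul_I]; push_cast; ring
    rw [this, Complex.exp_add, ← Complex.ofReal_exp, Complex.re_ofReal_mul,
      Complex.exp_ofReal_mul_I_re]

noncomputable def auxK (a μ : ℝ) : ℝ :=
  ∫ s in Ioi (0:ℝ), Real.exp (-a * Real.exp s) * Real.exp (-s * μ)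
noncomputable def auxC (a μ : ℝ) : ℝ :=
  ∫ s in (0:ℝ)..Real.pi, Real.exp (a * Real.cos s) * Real.cos (a * Real.sin s - μ * s)
noncomputable def auxG (a μ : ℝ) : ℝ :=
  (1 / Real.pi) * auxC a μ - (Real.sin (μ * Real.pi) / Real.pi) * auxK a μ

lemma auxK_bound (a μ s : ℝ) (ha : 0 < a) (hμ : -1 ≤ μ) (hs : 0 ≤ s) :
    |Real.exp (-a * Real.exp s) * Real.exp (-s * μ)| ≤ (2 / a ^ 2) * Real.exp (-s) := by
  rw [abs_of_pos (by positivity)]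
  have h1 : Real.exp (-s * μ) ≤ Real.exp s := Real.exp_le_exp.2 (by nlinarith)
  have h2 : Real.exp (-a * Real.exp s) ≤ 2 / (a * Real.exp s) ^ 2 := by
    have := Real.quadratic_le_exp_of_nonneg (x := a * Real.exp s) (by positivity)
    rw [neg_mul, Real.exp_neg, inv_le_comm₀ (by positivity) (by positivity), inv_div]
    have : 0 < a * Real.exp s := by positivity
    linarith
  calc _ ≤ 2 / (a * Real.exp s) ^ 2 * Real.exp s := by gcongr
    _ = _ := by rw [Real.exp_neg]; field_simp

lemma auxK_int (a μ : ℝ) (ha : 0 < a) (hμ : -1 ≤ μ) :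
    IntegrableOn (fun s => Real.exp (-a * Real.exp s) * Real.exp (-s * μ)) (Ioi (0:ℝ)) := by
  refine Integrable.mono' ((integrableOn_exp_neg_Ioi 0).const_mul (2 / a ^ 2)) ?_ ?_
  · exact (by fun_prop : Continuous _).aestronglyMeasurable
  · refine (ae_restrict_iff' measurableSet_Ioi).2 (Eventually.of_forall fun s hs => ?_)
    exact auxK_bound a μ s ha hμ (le_of_lt hs)

lemma auxK_rec (a μ : ℝ) (ha : 0 < a) (hμ : 0 ≤ μ) :
    μ * auxK a μ = Real.exp (-a) - a * auxK a (μ - 1) := by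
  have hd : ∀ s ∈ Ici (0:ℝ), HasDerivAt (fun s => Real.exp (-a * Real.exp s) * Real.exp (-s * μ))
      (-a * (Real.exp (-a * Real.exp s) * Real.exp (-s * (μ - 1))) -
        μ * (Real.exp (-a * Real.exp s) * Real.exp (-s * μ))) s := by
    intro s _
    have h1 : HasDerivAt (fun s => Real.exp (-a * Real.exp s))
      (Real.exp (-a * Real.exp s) * (-a * Real.exp s)) s :=
        ((Real.hasDerivAt_exp s).const_mul (-a)).exp
    have h2 : HasDerivAt (fun s => Real.exp (-s * μ)) (Real.exp (-s * μ) * (-1 * μ)) s :=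
      ((hasDerivAt_id s).neg.mul_const μ).exp
    convert! h1.mul h2 using 1
    rw [show -s * (μ - 1) = s + -s * μ by ring, Real.exp_add]
    ring
  have hi1 := (auxK_int a (μ - 1) ha (by linarith)).const_mul (-a)
  have hi2 := (auxK_int a μ ha (by linarith)).const_mul μ
  have ht : Tendsto (fun s => Real.exp (-a * Real.exp s) * Real.exp (-s * μ)) atTop (𝓝 0) := by
    have h0 : Tendsto (fun s => (2 / a ^ 2) * Real.exp (-s)) atTop (𝓝 0) := by
      simpa using (Real.tendsto_exp_neg_atTop_nhds_zero).const_mul (2 / a ^ 2)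
    refine squeeze_zero_norm' ?_ h0
    filter_upwards [eventually_ge_atTop 0] with s hs
    exact auxK_bound a μ s ha (by linarith) hs
  have := integral_Ioi_of_hasDerivAt_of_tendsto' hd (hi1.sub hi2) ht
  rw [integral_sub hi1 hi2, integral_const_mul, integral_const_mul] at this
  simp only [Real.exp_zero, neg_zero, zero_mul, mul_one] at this
  unfold auxK
  linarith

lemma auxC_rec (a μ : ℝ) :
    μ * auxC a μ = a * auxC a (μ - 1) + Real.exp (-a) * Real.sin (μ * Real.pi) := by
  have hd : ∀ s ∈ uIcc (0:ℝ) Real.pi, HasDerivAt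
      (fun s => Real.exp (a * Real.cos s) * Real.sin (a * Real.sin s - μ * s))
      (a * (Real.exp (a * Real.cos s) * Real.cos (a * Real.sin s - (μ - 1) * s)) -
        μ * (Real.exp (a * Real.cos s) * Real.cos (a * Real.sin s - μ * s))) s := by
    intro s _
    have h1 : HasDerivAt (fun s => Real.exp (a * Real.cos s))
      (Real.exp (a * Real.cos s) * (a * -Real.sin s)) s :=
        ((Real.hasDerivAt_cos s).const_mul a).exp
    have h2 : HasDerivAt (fun s => Real.sin (a * Real.sin s - μ * s))
      (Real.cos (a * Real.sin s - μ * s) * (a * Real.cos s - μ * 1)) s :=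
      (((Real.hasDerivAt_sin s).const_mul a).sub ((hasDerivAt_id s).const_mul μ)).sin
    convert! h1.mul h2 using 1
    rw [show a * Real.sin s - (μ - 1) * s = (a * Real.sin s - μ * s) + s by ring, Real.cos_add]
    ring
  have hi1 : IntervalIntegrable (fun s => a * (Real.exp (a * Real.cos s) * Real.cos (a * Real.sin s - (μ - 1) * s))) volume 0 Real.pi :=
    (by fun_prop : Continuous _).intervalIntegrable _ _
  have hi2 : IntervalIntegrable (fun s => μ * (Real.exp (a * Real.cos s) * Real.cos (a * Real.sin s - μ * s))) volume 0 Real.pi :=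
    (by fun_prop : Continuous _).intervalIntegrable _ _
  have := intervalIntegral.integral_eq_sub_of_hasDerivAt hd (hi1.sub hi2)
  rw [intervalIntegral.integral_sub hi1 hi2, intervalIntegral.integral_const_mul,
    intervalIntegral.integral_const_mul] at this
  simp only [Real.cos_pi, Real.sin_pi, Real.sin_zero, mul_zero, zero_sub, sub_zero,
    Real.sin_neg, mul_neg, mul_one] at this
  unfold auxC
  linarith

lemma auxG_rec (a μ : ℝ) (ha : 0 < a) (hμ : 0 ≤ μ) : μ * auxG a μ = a * auxG a (μ - 1) := by
  have h1 := auxK_rec a μ ha hμ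
  have h2 := auxC_rec a μ
  have h3 : Real.sin ((μ - 1) * Real.pi) = - Real.sin (μ * Real.pi) := by
    rw [sub_mul, one_mul, Real.sin_sub_pi]
  unfold auxG
  rw [h3]
  linear_combination (1 / Real.pi) * h2 - (Real.sin (μ * Real.pi) / Real.pi) * h1

lemma auxC_series (a μ : ℝ) : HasSum (fun n : ℕ => a ^ n / (n.factorial : ℝ) *
    ∫ s in (0:ℝ)..Real.pi, Real.cos ((n - μ) * s)) (auxC a μ) := by
  have := aux_hasSum (μ := volume.restrict (Ioc 0 Real.pi)) (w := fun _ => 1)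
    (integrable_const _) (aux_exp_abs a) (g := fun n s => Real.cos (n * s + -(μ * s)))
    (fun n => (by fun_prop : Continuous _).aestronglyMeasurable)
    (fun n => Eventually.of_forall fun s => Real.abs_cos_le_one _)
    (Eventually.of_forall fun s => aux_trig a s (-(μ * s)))
  unfold auxC
  simp_rw [intervalIntegral.integral_of_le Real.pi_pos.le]
  simp only [mul_one] at this
  simpa only [sub_mul, sub_eq_add_neg, neg_mul, add_mul] using this

lemma auxG_zero (a : ℝ) : auxG a 0 = 1 := by
  have h := auxC_series a 0
  have h2 : HasSum (fun n : ℕ => a ^ n / (n.factorial : ℝ) *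
    ∫ s in (0:ℝ)..Real.pi, Real.cos ((n - 0) * s)) Real.pi := by
    convert hasSum_single (α := ℝ) 0 ?_ using 1
    · simp
    · intro n hn
      have : (n:ℝ) ≠ 0 := by exact_mod_cast hn
      rw [sub_zero, intervalIntegral.integral_comp_mul_left (fun x => Real.cos x) this]
      simp [Real.sin_nat_mul_pi]
  unfold auxG
  rw [h.unique h2]
  simp [Real.pi_ne_zero]

lemma auxK_eq (a μ : ℝ) : auxK a μ = ∫ u in Ioi (1:ℝ), Real.exp (-a * u) * u ^ (-μ - 1) := by
  have him : Real.exp '' (Ioi 0) = Ioi 1 := by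
    ext x; constructor
    · rintro ⟨y, hy, rfl⟩; exact Real.one_lt_exp_iff.2 hy
    · intro hx
      have hx' : (1:ℝ) < x := hx
      exact ⟨Real.log x, Real.log_pos hx', Real.exp_log (by linarith)⟩
  rw [← him, integral_image_eq_integral_abs_deriv_smul measurableSet_Ioi
    (fun x _ => (Real.hasDerivAt_exp x).hasDerivWithinAt) Real.exp_injective.injOn]
  unfold auxK
  refine integral_congr_ae (Eventually.of_forall fun s => ?_)
  simp only [smul_eq_mul, abs_of_pos (Real.exp_pos s)]
  rw [← Real.exp_mul, ← Real.exp_add, ← Real.exp_add, ← Real.exp_add]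
  ring_nf

lemma auxG_base (a μ : ℝ) (ha : 0 < a) (h1 : -1 < μ) (h0 : μ < 0) :
    auxG a μ = a ^ μ / Real.Gamma (μ + 1) := by
  have hint : IntegrableOn (fun u : ℝ => u ^ (-μ - 1)) (Ioc 0 1) := by
    have := intervalIntegral.intervalIntegrable_rpow' (a := 0) (b := 1) (r := -μ - 1) (by linarith)
    rwa [intervalIntegrable_iff_integrableOn_Ioc_of_le zero_le_one] at this
  have hs := aux_hasSum (μ := volume.restrict (Ioc (0:ℝ) 1)) hint (aux_exp_abs (-a))
    (g := fun n u => u ^ n) (fun n => (by fun_prop : Continuous _).aestronglyMeasurable)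
    (fun n => (ae_restrict_iff' measurableSet_Ioc).2 (Eventually.of_forall fun u hu => by
      rw [abs_pow, abs_of_pos hu.1]; exact pow_le_one₀ hu.1.le hu.2))
    (G := fun u => Real.exp (-a * u))
    (Eventually.of_forall fun u => by
      convert aux_exp (-a * u) using 1
      ext n; rw [mul_pow]; ring)
  have hm : ∀ n : ℕ, ∫ u in Ioc (0:ℝ) 1, u ^ n * u ^ (-μ - 1) = 1 / (n - μ) := by
    intro n
    have : ∫ u in Ioc (0:ℝ) 1, u ^ n * u ^ (-μ - 1) = ∫ u in Ioc (0:ℝ) 1, u ^ (n - μ - 1) := by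
      refine setIntegral_congr_fun measurableSet_Ioc fun u hu => ?_
      rw [← Real.rpow_natCast, ← Real.rpow_add hu.1]; ring_nf
    have hn : (0:ℝ) ≤ n := n.cast_nonneg
    rw [this, ← intervalIntegral.integral_of_le zero_le_one, integral_rpow (Or.inl (by linarith))]
    rw [show (n - μ - 1 + 1 : ℝ) = n - μ by ring, Real.one_rpow, Real.zero_rpow (by linarith)]
    simp
  simp_rw [hm] at hs
  have hC := auxC_series a μ
  have hC' : auxC a μ = -Real.sin (μ * Real.pi) * ∫ u in Ioc (0:ℝ) 1, Real.exp (-a * u) * u ^ (-μ - 1) := by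
    refine hC.unique ?_
    convert! hs.mul_left (-Real.sin (μ * Real.pi)) using 1
    ext n
    have hn : (0:ℝ) ≤ n := n.cast_nonneg
    have hne : (n - μ : ℝ) ≠ 0 := by linarith
    rw [intervalIntegral.integral_comp_mul_left (fun x => Real.cos x) hne, integral_cos, sub_mul,
      Real.sin_nat_mul_pi_sub, neg_pow a n]
    simp only [mul_zero, Real.sin_zero, sub_zero, smul_eq_mul]
    field_simp
  have htot : IntegrableOn (fun u : ℝ => Real.exp (-a * u) * u ^ (-μ - 1)) (Ioi 0) := by
    have := integrableOn_rpow_mul_exp_neg_mul_rpow (s := -μ - 1) (p := 1) (b := a) (by linarith) one_pos ha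
    refine this.congr_fun (fun u _ => ?_) measurableSet_Ioi
    simp [mul_comm]
  have hsum : (∫ u in Ioc (0:ℝ) 1, Real.exp (-a * u) * u ^ (-μ - 1)) + auxK a μ =
      a ^ μ * Real.Gamma (-μ) := by
    rw [auxK_eq, ← setIntegral_union Ioc_disjoint_Ioi_same measurableSet_Ioi
      (htot.mono_set Ioc_subset_Ioi_self) (htot.mono_set (Ioi_subset_Ioi zero_le_one)),
      Ioc_union_Ioi_eq_Ioi zero_le_one]
    have := Real.integral_rpow_mul_exp_neg_mul_Ioi (a := -μ) (r := a) (by linarith) ha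
    simp_rw [mul_comm (Real.exp _), neg_mul]
    rw [this, one_div, Real.inv_rpow ha.le, Real.rpow_neg ha.le, inv_inv]
  have hr := Real.Gamma_mul_Gamma_one_sub (-μ)
  have hsin : Real.sin (μ * Real.pi) ≠ 0 := by
    have : Real.sin (-(μ * Real.pi)) > 0 := Real.sin_pos_of_pos_of_lt_pi
      (by nlinarith [Real.pi_pos]) (by nlinarith [Real.pi_pos])
    rw [Real.sin_neg] at this; linarith
  have hG : Real.Gamma (μ + 1) ≠ 0 := (Real.Gamma_pos_of_pos (by linarith)).ne'
  rw [show (1 - -μ) = μ + 1 by ring, show Real.pi * -μ = - (μ * Real.pi) by ring, Real.sin_neg] at hr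
  have hr' : Real.Gamma (-μ) = Real.pi / -Real.sin (μ * Real.pi) / Real.Gamma (μ + 1) := by
    rw [← hr]; field_simp
  unfold auxG
  rw [hC']
  calc _ = - (Real.sin (μ * Real.pi) / Real.pi) * ((∫ u in Ioc (0:ℝ) 1, Real.exp (-a * u) * u ^ (-μ - 1)) + auxK a μ) := by ring
    _ = _ := by
      rw [hsum, hr']
      have := Real.pi_ne_zero
      field_simp

lemma auxG_step (a μ : ℝ) (ha : 0 < a) (h1 : -1 < μ) (h0 : μ ≤ 0) (n : ℕ) :
    auxG a (μ + n) = a ^ (μ + n) / Real.Gamma (μ + n + 1) := by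
  induction n with
  | zero =>
    rcases h0.lt_or_eq with h | h
    · simpa using auxG_base a μ ha h1 h
    · simp [h, auxG_zero]
  | succ n ih =>
    have hn : (0:ℝ) ≤ n := n.cast_nonneg
    have hpos : 0 < μ + n + 1 := by linarith
    have h := auxG_rec a (μ + n + 1) ha hpos.le
    rw [show μ + n + 1 - 1 = μ + n by ring, ih] at h
    push_cast
    rw [← add_assoc, Real.Gamma_add_one hpos.ne', Real.rpow_add_one ha.ne']
    have := (Real.Gamma_pos_of_pos hpos).ne'
    field_simp
    field_simp at h
    linarith

lemma auxG_eq (a μ : ℝ) (ha : 0 < a) (h : 0 ≤ μ) :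
    auxG a μ = a ^ μ / Real.Gamma (μ + 1) := by
  have h1 := Nat.le_ceil μ
  have h2 := Nat.ceil_lt_add_one h
  have := auxG_step a (μ - ⌈μ⌉₊) ha (by linarith) (by linarith) ⌈μ⌉₊
  simpa using this

lemma aux_meas_I (a s : ℝ) : -(2 * a) * Real.cosh s = -a * Real.exp (-s) + -a * Real.exp s := by
  rw [Real.cosh_eq]; ring

lemma besselI_series (ν a : ℝ) (hν : 0 ≤ ν) (ha : 0 < a) :
    HasSum (fun k : ℕ => (a ^ 2) ^ k / ((k.factorial : ℝ) * Real.Gamma (k + ν + 1)))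
      (besselI ν (2 * a) / a ^ ν) := by
  have h1 := aux_hasSum (μ := volume.restrict (Ioc 0 Real.pi)) 
    (w := fun s => Real.exp (a * Real.cos s))
    (((by fun_prop : Continuous fun s => Real.exp (a * Real.cos s)).intervalIntegrable 0 Real.pi).1)
    (aux_exp_abs a) (g := fun n s => Real.cos (n * (-s) + (a * Real.sin s - ν * s)))
    (fun n => (by fun_prop : Continuous _).aestronglyMeasurable)
    (fun n => Eventually.of_forall fun s => Real.abs_cos_le_one _)
    (Eventually.of_forall fun s => aux_trig a (-s) (a * Real.sin s - ν * s))
  have h2 := aux_hasSum (μ := volume.restrict (Ioi (0:ℝ)))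
    (auxK_int a ν ha (by linarith)) (aux_exp_abs (-a)) (g := fun n s => Real.exp (-s) ^ n)
    (fun n => (by fun_prop : Continuous _).aestronglyMeasurable)
    (fun n => (ae_restrict_iff' measurableSet_Ioi).2 (Eventually.of_forall fun s hs => by
      rw [abs_of_pos (by positivity)]
      refine pow_le_one₀ (by positivity) (Real.exp_le_one_iff.2 ?_)
      have : 0 < s := hs
      linarith))
    (G := fun s => Real.exp (-a * Real.exp (-s)))
    (Eventually.of_forall fun s => by
      convert! aux_exp (-a * Real.exp (-s)) using 1
      ext n; rw [mul_pow]; ring)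
  have e1 : ∫ s in Ioc 0 Real.pi, (Real.exp (a * Real.cos (-s)) * Real.cos (a * Real.sin (-s) + (a * Real.sin s - ν * s))) * Real.exp (a * Real.cos s) = ∫ s in (0 : ℝ)..Real.pi, Real.exp (2 * a * Real.cos s) * Real.cos (ν * s) := by
    rw [intervalIntegral.integral_of_le Real.pi_pos.le]
    refine integral_congr_ae (Eventually.of_forall fun s => ?_)
    simp only [Real.cos_neg, Real.sin_neg]
    rw [show a * -Real.sin s + (a * Real.sin s - ν * s) = -(ν * s) by ring, Real.cos_neg,
      show 2 * a * Real.cos s = a * Real.cos s + a * Real.cos s by ring, Real.exp_add]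
    ring
  have e2 : ∫ s in Ioi (0:ℝ), Real.exp (-a * Real.exp (-s)) * (Real.exp (-a * Real.exp s) * Real.exp (-s * ν)) = ∫ s in Set.Ioi (0 : ℝ), Real.exp (-(2 * a) * Real.cosh s) * Real.exp (-s * ν) := by
    refine integral_congr_ae (Eventually.of_forall fun s => ?_)
    simp only
    rw [aux_meas_I, Real.exp_add]; ring
  rw [e1] at h1
  rw [e2] at h2
  have h3 := ((h1.mul_left (1 / Real.pi)).sub (h2.mul_left (Real.sin (ν * Real.pi) / Real.pi))).div_const (a ^ ν)
  unfold besselI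
  convert! h3 using 1
  ext k
  have hk : (0:ℝ) ≤ k := k.cast_nonneg
  have i1 : ∫ s in Ioc 0 Real.pi, Real.cos (k * (-s) + (a * Real.sin s - ν * s)) * Real.exp (a * Real.cos s) = auxC a (k + ν) := by
    unfold auxC
    rw [intervalIntegral.integral_of_le Real.pi_pos.le]
    refine integral_congr_ae (Eventually.of_forall fun s => ?_)
    simp only
    rw [mul_comm]; ring_nf
  have i2 : ∫ s in Ioi (0:ℝ), Real.exp (-s) ^ k * (Real.exp (-a * Real.exp s) * Real.exp (-s * ν)) = auxK a (k + ν) := by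
    unfold auxK
    refine integral_congr_ae (Eventually.of_forall fun s => ?_)
    simp only
    rw [← Real.exp_nat_mul, mul_add, Real.exp_add, mul_comm (-s) (k:ℝ)]; ring
  have hG := auxG_eq a (k + ν) ha (by linarith)
  have hsin : Real.sin ((k + ν) * Real.pi) = (-1) ^ k * Real.sin (ν * Real.pi) := by
    rw [add_mul, add_comm, Real.sin_add_nat_mul_pi]
  unfold auxG at hG
  rw [hsin, Real.rpow_add ha, Real.rpow_natCast] at hG
  rw [i1, i2, neg_pow a k]
  have hp : 0 < a ^ ν := Real.rpow_pos_of_pos ha _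
  have hg : 0 < Real.Gamma (k + ν + 1) := Real.Gamma_pos_of_pos (by linarith)
  have hf : (k.factorial : ℝ) ≠ 0 := by exact_mod_cast k.factorial_ne_zero
  have key : 1 / Real.pi * (a ^ k / (k.factorial : ℝ) * auxC a (k + ν)) -
     Real.sin (ν * Real.pi) / Real.pi * ((-1) ^ k * a ^ k / (k.factorial : ℝ) * auxK a (k + ν))
     = a ^ k / (k.factorial : ℝ) * (a ^ k * a ^ ν / Real.Gamma (k + ν + 1)) := by
    rw [← hG]; ring
  rw [key, ← pow_mul, mul_comm 2 k, pow_mul]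
  field_simp

lemma aux_beta (u v : ℝ) (hu : 0 < u) (hv : 0 < v) :
    ∫ x in Ioo (0:ℝ) 1, x ^ (u - 1) * (1 - x) ^ (v - 1) =
      Real.Gamma u * Real.Gamma v / Real.Gamma (u + v) := by
  have h := Complex.betaIntegral_eq_Gamma_mul_div u v (by simpa) (by simpa)
  rw [Complex.betaIntegral, intervalIntegral.integral_of_le zero_le_one,
    integral_Ioc_eq_integral_Ioo, ← Complex.ofReal_add, Complex.Gamma_ofReal, Complex.Gamma_ofReal,
    Complex.Gamma_ofReal, ← Complex.ofReal_mul, ← Complex.ofReal_div] at h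
  rw [← Complex.ofReal_inj, ← h, ← integral_complex_ofReal]
  refine setIntegral_congr_fun measurableSet_Ioo fun x hx => ?_
  have h1 : 0 ≤ 1 - x := by linarith [hx.2]
  rw [Complex.ofReal_mul, Complex.ofReal_cpow hx.1.le, Complex.ofReal_cpow h1]
  push_cast
  rfl

lemma aux_moment (ν : ℝ) (hν : 0 ≤ ν) (k : ℕ) :
    ∫ s in Ioo (0:ℝ) 1, s ^ (2 * k) * (1 - s ^ 2) ^ ((2 * ν - 1) / 2) =
      Real.Gamma (k + 1 / 2) * Real.Gamma (ν + 1 / 2) / Real.Gamma (k + ν + 1) / 2 := by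
  have hk : (0:ℝ) ≤ k := k.cast_nonneg
  have hb := aux_beta (k + 1 / 2) (ν + 1 / 2) (by linarith) (by linarith)
  rw [show (k + 1 / 2 + (ν + 1 / 2) : ℝ) = k + ν + 1 by ring] at hb
  rw [← hb, eq_div_iff two_ne_zero, mul_comm, ← integral_const_mul]
  have hc := integral_comp_rpow_Ioi_of_pos (p := 2) two_pos
    (g := (Ioo (0:ℝ) 1).indicator fun x => x ^ ((k:ℝ) + 1 / 2 - 1) * (1 - x) ^ (ν + 1 / 2 - 1))
  rw [setIntegral_indicator measurableSet_Ioo] at hc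
  rw [inter_eq_right.2 (fun x hx => hx.1)] at hc
  rw [← hc]
  have : ∫ s in Ioo (0:ℝ) 1, 2 * (s ^ (2 * k) * (1 - s ^ 2) ^ ((2 * ν - 1) / 2)) = 
     ∫ s in Ioi (0:ℝ), (Ioo (0:ℝ) 1).indicator (fun s => 2 * (s ^ (2 * k) * (1 - s ^ 2) ^ ((2 * ν - 1) / 2))) s := by
    rw [setIntegral_indicator measurableSet_Ioo, inter_eq_right.2 (fun x hx => hx.1)]
  rw [this]
  refine setIntegral_congr_fun measurableSet_Ioi fun s hs => ?_
  have hs' : (0:ℝ) < s := hs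
  have e : s ^ (2:ℝ) = s ^ 2 := by norm_cast
  simp only [smul_eq_mul, e]
  by_cases h : s < 1
  · have h2 : s ^ 2 < 1 := by nlinarith
    rw [indicator_of_mem (show s ∈ Ioo (0:ℝ) 1 from ⟨hs', h⟩),
      indicator_of_mem (show s ^ 2 ∈ Ioo (0:ℝ) 1 from ⟨by positivity, h2⟩)]
    rw [show (2 - 1 : ℝ) = 1 by norm_num, Real.rpow_one, ← e, ← Real.rpow_mul hs'.le,
      show (2 * ((k:ℝ) + 1 / 2 - 1)) = ((2 * k : ℕ) : ℝ) - 1 by push_cast; ring,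
      Real.rpow_sub_one hs'.ne', Real.rpow_natCast,
      show (2 * ν - 1) / 2 = ν + 1 / 2 - 1 by ring]
    field_simp
  · have h2 : 1 ≤ s ^ 2 := by nlinarith
    rw [indicator_of_notMem (fun hh => h hh.2), indicator_of_notMem (fun hh => by linarith [hh.2])]
    simp

lemma aux_half (k : ℕ) : Real.Gamma (k + 1 / 2) / ((2 * k).factorial : ℝ) =
    Real.Gamma (1 / 2) / (4 ^ k * (k.factorial : ℝ)) := by
  induction k with
  | zero => simp
  | succ k ih =>
    have hk : (0:ℝ) ≤ k := k.cast_nonneg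
    rw [show ((k + 1 : ℕ) : ℝ) + 1 / 2 = (k + 1 / 2) + 1 by push_cast; ring,
      Real.Gamma_add_one (by linarith), show 2 * (k + 1) = 2 * k + 1 + 1 by ring,
      Nat.factorial_succ, Nat.factorial_succ, Nat.factorial_succ]
    have h1 : ((2 * k).factorial : ℝ) ≠ 0 := by exact_mod_cast (2 * k).factorial_ne_zero
    have h2 : (k.factorial : ℝ) ≠ 0 := by exact_mod_cast k.factorial_ne_zero
    rw [div_eq_div_iff h1 (by positivity)] at ih
    rw [div_eq_div_iff (by positivity) (by positivity)]
    push_cast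
    rw [pow_succ]
    linear_combination (4 * (k + 1) * (k + 1 / 2)) * ih

lemma aux_wint (ν : ℝ) (hν : 0 ≤ ν) :
    IntegrableOn (fun s : ℝ => (1 - s ^ 2) ^ ((2 * ν - 1) / 2)) (Ioo 0 1) := by
  by_contra h
  have h1 := aux_moment ν hν 0
  simp only [mul_zero, pow_zero, one_mul] at h1
  rw [integral_undef h] at h1
  have : 0 < Real.Gamma ((0:ℕ) + 1 / 2) * Real.Gamma (ν + 1 / 2) / Real.Gamma ((0:ℕ) + ν + 1) / 2 := by
    have a1 := Real.Gamma_pos_of_pos (s := (0:ℕ) + 1 / 2) (by norm_num)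
    have a2 := Real.Gamma_pos_of_pos (s := ν + 1 / 2) (by linarith)
    have a3 := Real.Gamma_pos_of_pos (s := (0:ℕ) + ν + 1) (by push_cast; linarith)
    positivity
  linarith

lemma besselJ_series (ν r : ℝ) (hν : 0 ≤ ν) : ∃ j : ℝ, besselJ ν r = (j : ℂ) ∧
    HasSum (fun k : ℕ => (-1) ^ k / ((k.factorial : ℝ) * Real.Gamma (k + ν + 1)) *
      ((r / 2) ^ ν * ((r / 2) ^ 2) ^ k)) j := by
  set w : ℝ → ℝ := fun s => (1 - s ^ 2) ^ ((2 * ν - 1) / 2) with hw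
  have hwi := aux_wint ν hν
  have hcs : Summable (fun n : ℕ => |(-1) ^ n * r ^ (2 * n) / ((2 * n).factorial : ℝ)|) :=
    (Real.hasSum_cos r).summable.abs
  have hs := aux_hasSum (μ := volume.restrict (Ioo (0:ℝ) 1)) hwi hcs
    (g := fun n s => s ^ (2 * n)) (fun n => (by fun_prop : Continuous _).aestronglyMeasurable)
    (fun n => (ae_restrict_iff' measurableSet_Ioo).2 (Eventually.of_forall fun u hu => by
      rw [abs_pow, abs_of_pos hu.1]; exact pow_le_one₀ hu.1.le hu.2.le))
    (G := fun s => Real.cos (s * r))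
    (Eventually.of_forall fun s => by
      convert! Real.hasSum_cos (s * r) using 1
      ext n; rw [mul_pow]; ring)
  simp_rw [aux_moment ν hν] at hs
  have hwI : IntervalIntegrable (fun s => (w s : ℂ)) volume 0 1 := by
    rw [intervalIntegrable_iff_integrableOn_Ioo_of_le zero_le_one]
    exact Integrable.ofReal hwi
  have hf : IntervalIntegrable (fun s : ℝ => Complex.exp (Complex.I * (s : ℂ) * (r : ℂ)) * (w s : ℂ)) volume 0 1 :=
    hwI.continuousOn_mul (by fun_prop)
  have hf' : IntervalIntegrable (fun s : ℝ => Complex.exp (Complex.I * ((-s : ℝ) : ℂ) * (r : ℂ)) * (w (-s) : ℂ)) volume 0 1 := by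
    have : ∀ s, w (-s) = w s := fun s => by simp [hw]
    simp_rw [this]
    exact hwI.continuousOn_mul (by fun_prop)
  have hf2 : IntervalIntegrable (fun s : ℝ => Complex.exp (Complex.I * (s : ℂ) * (r : ℂ)) * (w s : ℂ)) volume (-1) 0 := by
    have := (hf'.comp_sub_left 0).symm
    simpa using this
  have hJ : ∫ s in (-1 : ℝ)..1, Complex.exp (Complex.I * (s : ℂ) * (r : ℂ)) * (w s : ℂ) =
      ((2 * ∫ s in Ioo (0:ℝ) 1, Real.cos (s * r) * w s : ℝ) : ℂ) := by
    rw [← intervalIntegral.integral_add_adjacent_intervals hf2 hf]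
    have := intervalIntegral.integral_comp_neg (a := 0) (b := 1) (fun s : ℝ => Complex.exp (Complex.I * (s : ℂ) * (r : ℂ)) * (w s : ℂ))
    rw [neg_zero] at this
    rw [← this, ← intervalIntegral.integral_add hf' hf, intervalIntegral.integral_of_le zero_le_one,
      integral_Ioc_eq_integral_Ioo, ← integral_const_mul, ← integral_complex_ofReal]
    refine integral_congr_ae (Eventually.of_forall fun s => ?_)
    have hws : w (-s) = w s := by simp [hw]
    simp only [hws]
    push_cast
    rw [← mul_assoc, Complex.two_cos, ← add_mul]
    ring_nf
  have h := hs.mul_left ((r / 2) ^ ν / (Real.Gamma (ν + 1 / 2) * Real.Gamma (1 / 2)) * 2)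
  refine ⟨(r / 2) ^ ν / (Real.Gamma (ν + 1 / 2) * Real.Gamma (1 / 2)) * 2 * ∫ s in Ioo (0:ℝ) 1, Real.cos (s * r) * w s, ?_, ?_⟩
  · unfold besselJ
    rw [hJ]
    push_cast
    ring
  · convert! h using 1
    ext k
    have hk : (0:ℝ) ≤ k := k.cast_nonneg
    have a1 := aux_half k
    have a2 := Real.Gamma_pos_of_pos (s := ν + 1 / 2) (by linarith)
    have a3 := Real.Gamma_pos_of_pos (s := k + ν + 1) (by linarith)
    have a4 := Real.Gamma_pos_of_pos (s := 1 / 2) (by norm_num)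
    have h1 : ((2 * k).factorial : ℝ) ≠ 0 := by exact_mod_cast (2 * k).factorial_ne_zero
    have h2 : (k.factorial : ℝ) ≠ 0 := by exact_mod_cast k.factorial_ne_zero
    calc _ = (-1) ^ k * (r / 2) ^ ν / Real.Gamma (k + ν + 1) / Real.Gamma (1 / 2) * r ^ (2 * k) * (Real.Gamma (1 / 2) / (4 ^ k * (k.factorial : ℝ))) := by
          rw [div_pow r 2 2, div_pow, ← pow_mul, show (2:ℝ) ^ 2 = 4 by norm_num]
          field_simp
      _ = _ := by
        rw [← a1]; field_simp

lemma aux_vand (j : ℕ) : ∀ (k : ℕ) (ν : ℝ), 0 ≤ ν →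
    Real.Gamma (j + k + ν + 1) / ((k.factorial : ℝ) * Real.Gamma (j + ν + 1)) =
    ∑ m ∈ Finset.range (k + 1), (j.choose m : ℝ) *
      (Real.Gamma (k + ν + 1) / (((k - m).factorial : ℝ) * Real.Gamma (m + ν + 1))) := by
  induction j with
  | zero =>
    intro k ν hν
    rw [Finset.sum_range_succ', Finset.sum_eq_zero]
    · simp
    · intro m _; simp
  | succ j ih =>
    intro k ν hν
    have hj : (0:ℝ) ≤ j := j.cast_nonneg
    cases k with
    | zero =>
      have a1 := (Real.Gamma_pos_of_pos (s := j + 1 + ν + 1) (by linarith)).ne'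
      have a2 := (Real.Gamma_pos_of_pos (s := ν + 1) (by linarith)).ne'
      simp [a1, a2]
    | succ k =>
      have hk : (0:ℝ) ≤ k := k.cast_nonneg
      have i1 := ih (k + 1) ν hν
      have i2 := ih k (ν + 1) (by linarith)
      rw [Finset.sum_range_succ'] at i1 ⊢
      have hsplit : ∑ m ∈ Finset.range (k + 1), (((j + 1).choose (m + 1) : ℕ) : ℝ) *
      (Real.Gamma ((k + 1 : ℕ) + ν + 1) / (((k + 1 - (m + 1)).factorial : ℝ) * Real.Gamma ((m + 1 : ℕ) + ν + 1)))
       = ∑ m ∈ Finset.range (k + 1), (j.choose m : ℝ) *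
      (Real.Gamma (k + (ν + 1) + 1) / (((k - m).factorial : ℝ) * Real.Gamma (m + (ν + 1) + 1))) + 
      ∑ m ∈ Finset.range (k + 1), ((j.choose (m + 1) : ℕ) : ℝ) *
      (Real.Gamma ((k + 1 : ℕ) + ν + 1) / (((k + 1 - (m + 1)).factorial : ℝ) * Real.Gamma ((m + 1 : ℕ) + ν + 1))) := by
        rw [← Finset.sum_add_distrib]
        refine Finset.sum_congr rfl fun m _ => ?_
        rw [Nat.choose_succ_succ, Nat.add_sub_add_right]
        push_cast
        rw [show (k:ℝ) + (ν + 1) + 1 = k + 1 + ν + 1 by ring, show (m:ℝ) + (ν + 1) + 1 = m + 1 + ν + 1 by ring]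
        ring
      rw [hsplit, ← i2, Nat.choose_zero_right, add_assoc (_ / _)]
      rw [Nat.choose_zero_right] at i1
      rw [← i1]
      push_cast
      rw [show (j:ℝ) + 1 + (k + 1) + ν + 1 = (j + k + ν + 1 + 1) + 1 by ring,
        show (j:ℝ) + k + (ν + 1) + 1 = j + k + ν + 1 + 1 by ring,
        show (j:ℝ) + (k + 1) + ν + 1 = j + k + ν + 1 + 1 by ring,
        show (j:ℝ) + 1 + ν + 1 = (j + ν + 1) + 1 by ring,
        show (j:ℝ) + (ν + 1) + 1 = (j + ν + 1) + 1 by ring,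
        Real.Gamma_add_one (s := j + k + ν + 1 + 1) (by linarith),
        Real.Gamma_add_one (s := j + ν + 1) (by linarith), Nat.factorial_succ]
      have a1 := (Real.Gamma_pos_of_pos (s := j + ν + 1) (by linarith)).ne'
      have h2 : (k.factorial : ℝ) ≠ 0 := by exact_mod_cast k.factorial_ne_zero
      have h3 : (j:ℝ) + ν + 1 ≠ 0 := by linarith
      push_cast
      field_simp
      ring

set_option maxHeartbeats 2000000 in
lemma aux_triple (ν x y S : ℝ) (hν : 0 ≤ ν)
    (hS : HasSum (fun k : ℕ => (x * y) ^ k / ((k.factorial : ℝ) * Real.Gamma (k + ν + 1))) S) :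
    HasSum (fun p : ℕ × ℕ => x ^ p.1 * y ^ p.2 * (Real.Gamma (p.1 + p.2 + ν + 1) /
      ((p.1.factorial : ℝ) * (p.2.factorial : ℝ) * Real.Gamma (p.1 + ν + 1) * Real.Gamma (p.2 + ν + 1))))
      (Real.exp x * Real.exp y * S) := by
  have h1 := aux_exp x
  have h2 := aux_exp y
  have h12 := h1.mul h2 (summable_mul_of_summable_norm h1.summable.norm h2.summable.norm)
  have h3 := h12.mul hS (summable_mul_of_summable_norm h12.summable.norm hS.summable.norm)
  obtain ⟨e, hhe⟩ : ∃ e : (ℕ × ℕ) × ℕ → (ℕ × ℕ) × ℕ, e = fun q => ((q.1.1 + q.2, q.1.2 + q.2), q.2) := ⟨_, rfl⟩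
  have he : Function.Injective e := by
    rintro ⟨⟨a, b⟩, c⟩ ⟨⟨a', b'⟩, c'⟩ h
    simp only [hhe, Prod.mk.injEq] at h ⊢
    omega
  obtain ⟨g, hg⟩ : ∃ g : (ℕ × ℕ) × ℕ → ℝ, g = fun q => if q.2 ≤ q.1.1 ∧ q.2 ≤ q.1.2 then
    x ^ (q.1.1 - q.2) / ((q.1.1 - q.2).factorial : ℝ) * (y ^ (q.1.2 - q.2) / ((q.1.2 - q.2).factorial : ℝ))
      * ((x * y) ^ q.2 / ((q.2.factorial : ℝ) * Real.Gamma (q.2 + ν + 1))) else 0 := ⟨_, rfl⟩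
  have h4 : HasSum g (Real.exp x * Real.exp y * S) := by
    rw [← he.hasSum_iff]
    · convert! h3 using 1
      ext ⟨⟨a, b⟩, c⟩
      simp [hg, hhe]
    · rintro ⟨⟨a, b⟩, c⟩ hn
      simp only [hg]
      rw [if_neg]
      rintro ⟨ha, hb⟩
      apply hn
      refine ⟨((a - c, b - c), c), ?_⟩
      have ha' : c ≤ a := ha
      have hb' : c ≤ b := hb
      simp only [hhe, Nat.sub_add_cancel ha', Nat.sub_add_cancel hb']
  refine h4.prod_fiberwise fun p => ?_
  obtain ⟨j, k⟩ := p
  have hz : ∀ m ∉ Finset.range (k + 1), g ((j, k), m) = 0 := by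
    intro m hm
    simp only [Finset.mem_range] at hm
    simp only [hg]
    rw [if_neg]
    rintro ⟨_, hb⟩
    have hb' : m ≤ k := hb
    omega
  have hfin : HasSum (fun m => g ((j, k), m)) (∑ m ∈ Finset.range (k + 1), g ((j, k), m)) :=
    hasSum_sum_of_ne_finset_zero hz
  convert! hfin using 1
  have hj : (0:ℝ) ≤ j := j.cast_nonneg
  have hk : (0:ℝ) ≤ k := k.cast_nonneg
  have a1 := (Real.Gamma_pos_of_pos (s := k + ν + 1) (by linarith)).ne'
  have a2 := (Real.Gamma_pos_of_pos (s := j + ν + 1) (by linarith)).ne'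
  have f1 : (j.factorial : ℝ) ≠ 0 := by exact_mod_cast j.factorial_ne_zero
  have f2 : (k.factorial : ℝ) ≠ 0 := by exact_mod_cast k.factorial_ne_zero
  have hv := aux_vand j k ν hν
  calc _ = x ^ j * y ^ k / ((j.factorial : ℝ) * Real.Gamma (k + ν + 1)) *
        (Real.Gamma (j + k + ν + 1) / ((k.factorial : ℝ) * Real.Gamma (j + ν + 1))) := by
        field_simp
    _ = _ := by
      rw [hv, Finset.mul_sum]
      refine Finset.sum_congr rfl fun m hm => ?_
      have hmk : m ≤ k := by simpa [Nat.lt_succ_iff] using hm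
      simp only [hg]
      have hm0 : (0:ℝ) ≤ m := m.cast_nonneg
      have a3 := (Real.Gamma_pos_of_pos (s := m + ν + 1) (by linarith)).ne'
      split_ifs with hc
      · have hmj : m ≤ j := hc.1
        rw [Nat.cast_choose ℝ hmj]
        have f3 : ((j - m).factorial : ℝ) ≠ 0 := by exact_mod_cast (j - m).factorial_ne_zero
        have f4 : ((k - m).factorial : ℝ) ≠ 0 := by exact_mod_cast (k - m).factorial_ne_zero
        have f5 : (m.factorial : ℝ) ≠ 0 := by exact_mod_cast m.factorial_ne_zero
        rw [← pow_sub_mul_pow x hmj, ← pow_sub_mul_pow y hmk, mul_pow]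
        field_simp
      · have : j < m := by
          by_contra hh
          exact hc ⟨not_lt.1 hh, hmk⟩
        rw [Nat.choose_eq_zero_of_lt this]; simp

lemma aux_gauss (ν t : ℝ) (hν : 0 ≤ ν) (ht : 0 < t) (n : ℕ) :
    IntegrableOn (fun ρ : ℝ => Real.exp (-t * ρ ^ 2) * (ρ ^ (2 * ν) * (ρ ^ 2) ^ n) * ρ) (Ioi 0) ∧
    ∫ ρ in Ioi (0:ℝ), Real.exp (-t * ρ ^ 2) * (ρ ^ (2 * ν) * (ρ ^ 2) ^ n) * ρ =
      (2 * t)⁻¹ * (t ^ ν)⁻¹ * (t ^ n)⁻¹ * Real.Gamma (n + ν + 1) := by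
  have hn : (0:ℝ) ≤ n := n.cast_nonneg
  have hq : -1 < 2 * ν + 2 * n + 1 := by linarith
  have hcong : ∀ ρ ∈ Ioi (0:ℝ), ρ ^ (2 * ν + 2 * n + 1) * Real.exp (-t * ρ ^ (2:ℝ)) =
      Real.exp (-t * ρ ^ 2) * (ρ ^ (2 * ν) * (ρ ^ 2) ^ n) * ρ := by
    intro ρ hρ
    have hρ' : (0:ℝ) < ρ := hρ
    rw [Real.rpow_add hρ', Real.rpow_add hρ', Real.rpow_one,
      show (2 * n : ℝ) = ((2 * n : ℕ) : ℝ) by push_cast; ring, Real.rpow_natCast, pow_mul,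
      Real.rpow_two]
    ring
  constructor
  · exact (integrableOn_rpow_mul_exp_neg_mul_rpow (s := 2 * ν + 2 * n + 1) (p := 2) hq two_pos ht).congr_fun
      hcong measurableSet_Ioi
  · rw [← setIntegral_congr_fun measurableSet_Ioi hcong,
      integral_rpow_mul_exp_neg_mul_rpow two_pos hq ht,
      show -(2 * ν + 2 * n + 1 + 1) / 2 = -(ν + n + 1) by ring,
      show (2 * ν + 2 * n + 1 + 1) / 2 = n + ν + 1 by ring, Real.rpow_neg ht.le,
      Real.rpow_add ht, Real.rpow_add ht, Real.rpow_one, Real.rpow_natCast]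
    have : 0 < t ^ ν := Real.rpow_pos_of_pos ht _
    field_simp

theorem stmt13 (ν r₁ r₂ t : ℝ) (hν : 0 ≤ ν) (h1 : 0 < r₁) (h2 : 0 < r₂) (ht : 0 < t) :
    (∫ ρ in Set.Ioi (0 : ℝ),
        ((Real.exp (-t * ρ ^ 2) : ℝ) : ℂ) * besselJ ν (r₁ * ρ) * besselJ ν (r₂ * ρ) * (ρ : ℂ)) =
      ((((2 * t)⁻¹ * Real.exp (-(r₁ ^ 2 + r₂ ^ 2) / (4 * t)) *
          besselI ν (r₁ * r₂ / (2 * t))) : ℝ) : ℂ) := by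
  choose j hj hjs using fun r => besselJ_series ν r hν
  simp_rw [hj]
  set a := r₁ * r₂ / (4 * t) with ha_def
  have ha : 0 < a := by positivity
  have hI := besselI_series ν a hν ha
  have hz : r₁ * r₂ / (2 * t) = 2 * a := by rw [ha_def]; field_simp; norm_num
  set x := r₁ ^ 2 / (4 * t) with hx
  set y := r₂ ^ 2 / (4 * t) with hy
  have hxy : a ^ 2 = x * y := by rw [ha_def, hx, hy]; field_simp
  rw [hxy] at hI
  have hpos := aux_triple ν x y _ hν hI
  have hneg := aux_triple ν (-x) (-y) _ hν (by rw [neg_mul_neg]; exact hI)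
  have hav : a ^ ν = (r₁ / 2) ^ ν * (r₂ / 2) ^ ν * (t ^ ν)⁻¹ := by
    rw [← Real.mul_rpow (by positivity) (by positivity), ← Real.inv_rpow ht.le,
      ← Real.mul_rpow (by positivity) (by positivity)]
    congr 1; rw [ha_def]; field_simp; norm_num
  -- the terms
  let A : ℕ → ℝ := fun k => (-1) ^ k / ((k.factorial : ℝ) * Real.Gamma (k + ν + 1))
  let c : ℕ × ℕ → ℝ := fun p => A p.1 * ((r₁ / 2) ^ ν * ((r₁ / 2) ^ 2) ^ p.1) *
    (A p.2 * ((r₂ / 2) ^ ν * ((r₂ / 2) ^ 2) ^ p.2))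
  let h : ℕ → ℝ → ℝ := fun n ρ => Real.exp (-t * ρ ^ 2) * (ρ ^ (2 * ν) * (ρ ^ 2) ^ n) * ρ
  let F : ℕ × ℕ → ℝ → ℝ := fun p ρ => c p * h (p.1 + p.2) ρ
  have hFi : ∀ p, IntegrableOn (F p) (Ioi 0) := fun p =>
    (aux_gauss ν t hν ht (p.1 + p.2)).1.const_mul (c p)
  have hval : ∀ p : ℕ × ℕ, c p * ∫ ρ in Ioi (0:ℝ), h (p.1 + p.2) ρ = (2 * t)⁻¹ * a ^ ν *
      ((-x) ^ p.1 * (-y) ^ p.2 * (Real.Gamma (p.1 + p.2 + ν + 1) /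
      ((p.1.factorial : ℝ) * (p.2.factorial : ℝ) * Real.Gamma (p.1 + ν + 1) * Real.Gamma (p.2 + ν + 1)))) := by
    rintro ⟨m, n⟩
    simp only [h]
    rw [(aux_gauss ν t hν ht (m + n)).2, hav]
    simp only [c, A]
    rw [neg_pow x, neg_pow y]
    have ex : x ^ m = ((r₁ / 2) ^ 2) ^ m * (t ^ m)⁻¹ := by
      rw [← inv_pow, ← mul_pow]; congr 1; rw [hx]; field_simp; norm_num
    have ey : y ^ n = ((r₂ / 2) ^ 2) ^ n * (t ^ n)⁻¹ := by
      rw [← inv_pow, ← mul_pow]; congr 1; rw [hy]; field_simp; norm_num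
    rw [ex, ey, pow_add]
    push_cast
    simp only [div_eq_mul_inv, mul_inv]
    ring
  have hFs : Summable fun p => ∫ ρ in Ioi (0:ℝ), ‖F p ρ‖ := by
    refine ((hpos.mul_left ((2 * t)⁻¹ * a ^ ν)).summable).congr fun p => ?_
    have e1 : ∫ ρ in Ioi (0:ℝ), ‖F p ρ‖ = |c p| * ∫ ρ in Ioi (0:ℝ), h (p.1 + p.2) ρ := by
      rw [← integral_const_mul]
      refine setIntegral_congr_fun measurableSet_Ioi fun ρ hρ => ?_
      have hρ' : (0:ℝ) < ρ := hρ
      simp only [F, Real.norm_eq_abs, abs_mul]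
      congr 1
      exact abs_of_nonneg (by simp only [h]; positivity)
    have e2 : 0 ≤ ∫ ρ in Ioi (0:ℝ), h (p.1 + p.2) ρ :=
      setIntegral_nonneg measurableSet_Ioi fun ρ hρ => by
        have hρ' : (0:ℝ) < ρ := hρ
        simp only [h]; positivity
    rw [e1, ← abs_of_nonneg e2, ← abs_mul, hval]
    have g1 := Real.Gamma_pos_of_pos (s := p.1 + p.2 + ν + 1) (by positivity)
    have g2 := Real.Gamma_pos_of_pos (s := p.1 + ν + 1) (by positivity)
    have g3 := Real.Gamma_pos_of_pos (s := p.2 + ν + 1) (by positivity)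
    have hx0 : 0 < x := by positivity
    have hy0 : 0 < y := by positivity
    rw [abs_mul, abs_mul ((-x) ^ p.1 * (-y) ^ p.2), abs_mul ((-x) ^ p.1), abs_pow, abs_pow, abs_neg, abs_neg,
      abs_of_pos hx0, abs_of_pos hy0, abs_of_nonneg (a := (2 * t)⁻¹ * a ^ ν) (by positivity),
      abs_of_nonneg (a := Real.Gamma (p.1 + p.2 + ν + 1) / _) (by positivity)]
  have hsum := hasSum_integral_of_summable_integral_norm hFi hFs
  have hsum2 : HasSum (fun p => ∫ ρ in Ioi (0:ℝ), F p ρ) ((2 * t)⁻¹ * a ^ ν * (Real.exp (-x) * Real.exp (-y) *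
      (besselI ν (2 * a) / a ^ ν))) := by
    refine (hneg.mul_left ((2 * t)⁻¹ * a ^ ν)).congr_fun ?_
    intro p
    simp only [F]
    rw [integral_const_mul, hval]
  have hres := hsum.unique hsum2
  have hpt : ∀ ρ ∈ Ioi (0:ℝ), ∑' p, F p ρ = Real.exp (-t * ρ ^ 2) * j (r₁ * ρ) * j (r₂ * ρ) * ρ := by
    intro ρ hρ
    have hρ' : (0:ℝ) < ρ := hρ
    have s1 := hjs (r₁ * ρ)
    have s2 := hjs (r₂ * ρ)
    have s3 := (s1.mul s2 (summable_mul_of_summable_norm s1.summable.norm s2.summable.norm)).mul_left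
      (Real.exp (-t * ρ ^ 2) * ρ)
    have : HasSum (fun p => F p ρ) (Real.exp (-t * ρ ^ 2) * ρ * (j (r₁ * ρ) * j (r₂ * ρ))) := by
      refine s3.congr_fun ?_
      rintro ⟨m, n⟩
      simp only [F, c, A, h]
      rw [show r₁ * ρ / 2 = (r₁ / 2) * ρ by ring, show r₂ * ρ / 2 = (r₂ / 2) * ρ by ring,
        Real.mul_rpow (by positivity) hρ'.le, Real.mul_rpow (by positivity) hρ'.le,
        show 2 * ν = ν + ν by ring, Real.rpow_add hρ', mul_pow, mul_pow, mul_pow, mul_pow, pow_add]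
      ring
    rw [this.tsum_eq]; ring
  rw [setIntegral_congr_fun measurableSet_Ioi hpt] at hres
  have hav0 : 0 < a ^ ν := by positivity
  have hfin : (2 * t)⁻¹ * Real.exp (-(r₁ ^ 2 + r₂ ^ 2) / (4 * t)) * besselI ν (r₁ * r₂ / (2 * t)) =
     ∫ ρ in Ioi (0:ℝ), Real.exp (-t * ρ ^ 2) * j (r₁ * ρ) * j (r₂ * ρ) * ρ := by
    rw [hres, hz, ← Real.exp_add, show -x + -y = -(r₁ ^ 2 + r₂ ^ 2) / (4 * t) by rw [hx, hy]; ring]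
    field_simp
  rw [hfin, ← integral_complex_ofReal]
  push_cast
  rfl
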